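/- For every integer γ ≥ 2 and every integer r ≥ 0, there exist a prime number p and permutations σ, τ of a set with p elements (e.g. Fin p) such that: (i) the subgroup of the symmetric group generated by σ and τ acts transitively on the p points; (ii) the cycle type of the commutator [σ,τ] = σ∘τ∘σ⁻¹∘τ⁻¹ consists of exactly γ−1 cycles, each of length 3 (in Mathlib terms, Equiv.Perm.cycleType [σ,τ] = Multiset.replicate (γ−1) 3); (iii) p > 3(γ−1), so the commutator has at least one fixed point; and (iv) the total number of cycles of the commutator counting fixed points, namely p − 2(γ−1), is at least r. -/

import Mathlib

open Equiv Equiv.Perm in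
/-- If `3 * n ≤ p`, some `τ` fixing every point from `3 * n` on has a commutator with the rotation of
`Fin p` that is a product of `n` disjoint three-cycles supported on the points below `3 * n`. -/
theorem exists_commutator_finRotate_cycleType (p n : ℕ) (hn : 3 * n ≤ p) :
    ∃ τ : Perm (Fin p),
      (∀ x : Fin p, 3 * n ≤ x.val →
        τ x = x ∧ (finRotate p * τ * (finRotate p)⁻¹ * τ⁻¹) x = x) ∧
      (finRotate p * τ * (finRotate p)⁻¹ * τ⁻¹).cycleType = Multiset.replicate n 3 := by
  induction n with
  | zero => exact ⟨1, by simp, by simp⟩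
  | succ n ih =>
    obtain ⟨τ, hfix, htype⟩ := ih (by omega)
    obtain ⟨q, rfl⟩ : ∃ q, p = q + 1 := ⟨p - 1, by omega⟩
    set ρ := finRotate (q + 1)
    let a : Fin (q + 1) := ⟨3 * n, by omega⟩
    let b : Fin (q + 1) := ⟨3 * n + 1, by omega⟩
    let c : Fin (q + 1) := ⟨3 * n + 2, by omega⟩
    have hρa : ρ a = b := finRotate_of_lt (by omega)
    have hρb : ρ b = c := finRotate_of_lt (by omega)
    have hab : a ≠ b := by simp [a, b]
    have hac : a ≠ c := by simp [a, c]
    have hbc : b ≠ c := by simp [b, c]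
    let κ := swap b c * swap a b
    have hconj : ρ * swap a b * ρ⁻¹ = swap b c := by
      rw [← hρa, ← hρb, hρa, mul_swap_eq_swap_mul, mul_inv_cancel_right, hρa, hρb]
    have hκ : κ.IsThreeCycle := by
      have h := isThreeCycle_swap_mul_swap_same hbc hab.symm hac.symm
      rwa [swap_comm b a] at h
    have hκfix : ∀ x, x ≠ a → x ≠ b → x ≠ c → κ x = x := fun x ha hb hc => by
      simp only [κ, Perm.mul_apply, swap_apply_of_ne_of_ne ha hb, swap_apply_of_ne_of_ne hb hc]
    have hdisj : ∀ f : Perm (Fin (q + 1)), (∀ x : Fin (q + 1), 3 * n ≤ x.val → f x = x) →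
        f.Disjoint κ := fun f hf x => by
      by_cases hx : 3 * n ≤ x.val
      · exact .inl (hf x hx)
      · refine .inr (hκfix x ?_ ?_ ?_) <;> rintro rfl <;> simp [a, b, c] at hx
    have hcomm : ρ * (τ * swap a b) * ρ⁻¹ * (τ * swap a b)⁻¹ = ρ * τ * ρ⁻¹ * τ⁻¹ * κ := by
      have hτ : τ⁻¹ * κ = κ * τ⁻¹ :=
        (hdisj τ fun x hx => (hfix x hx).1).commute.inv_left.eq
      rw [mul_assoc _ τ⁻¹, hτ]
      simp only [κ, ← hconj, mul_inv_rev, swap_inv]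
      group
    refine ⟨τ * swap a b, fun x hx => ?_, ?_⟩
    · have ha : x ≠ a := by rintro rfl; simp [a] at hx
      have hb : x ≠ b := by rintro rfl; simp [b] at hx; omega
      have hc : x ≠ c := by rintro rfl; simp [c] at hx; omega
      have hx' := hfix x (by omega)
      refine ⟨?_, ?_⟩
      · rw [Perm.mul_apply, swap_apply_of_ne_of_ne ha hb, hx'.1]
      · rw [hcomm, Perm.mul_apply, hκfix x ha hb hc, hx'.2]
    · rw [hcomm, (hdisj _ fun x hx => (hfix x hx).2).cycleType_mul, htype, hκ.cycleType,
        Multiset.replicate_succ, add_comm, Multiset.singleton_add]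

/-- Combinatorial form of Lemma 2.1: for each `γ ≥ 2` and `r ≥ 0` there is a
non-uniform origami of prime degree `p`, encoded by a transitive pair of
permutations `σ, τ` of `Fin p`, whose commutator has cycle type consisting of
exactly `γ - 1` cycles of length `3`, with `p > 3(γ-1)` (so at least one fixed
point), and whose total number of cycles counting fixed points, `p - 2(γ-1)`,
is at least `r`. -/
theorem origami_monodromy_exists (γ r : ℕ) (hγ : 2 ≤ γ) :
    ∃ (p : ℕ), p.Prime ∧ ∃ σ τ : Equiv.Perm (Fin p),
      (∀ x y : Fin p, ∃ g ∈ Subgroup.closure ({σ, τ} : Set (Equiv.Perm (Fin p))), g x = y) ∧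
      (σ * τ * σ⁻¹ * τ⁻¹).cycleType = Multiset.replicate (γ - 1) 3 ∧
      3 * (γ - 1) < p ∧
      r ≤ p - 2 * (γ - 1) := by
  obtain ⟨p, hp, hprime⟩ := Nat.exists_infinite_primes (3 * (γ - 1) + r + 2)
  obtain ⟨τ, -, hτ⟩ := exists_commutator_finRotate_cycleType p (γ - 1) (by omega)
  refine ⟨p, hprime, finRotate p, τ, fun x y => ?_, hτ, by omega, by omega⟩
  have hmoved : ∀ z : Fin p, finRotate p z ≠ z := fun z => by
    rw [← Equiv.Perm.mem_support, support_finRotate_of_le (by omega)]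
    exact Finset.mem_univ z
  obtain ⟨k, hk⟩ := (isCycle_finRotate_of_le (by omega)).exists_pow_eq (hmoved x) (hmoved y)
  exact ⟨finRotate p ^ k, pow_mem (Subgroup.subset_closure (by simp)) k, hk⟩
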